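/- arXiv:2011.11839 — 16 statements merged into one kernel-verified Lean document; each statement's English description precedes it below -/
import Mathlib

section
/- Let Γ be a connected simple graph on a finite vertex type V with at least two vertices, and let u ≠ v be vertices. Then the transposition swapping u and v is an automorphism of Γ if and only if for every integer i ≥ 1, the set {x : V | dist(u,x) = i} \ {v} equals the set {x : V | dist(v,x) = i} \ {u} (where dist denotes graph distance). -/
/-- In a connected simple graph on at least two vertices, the transposition
swapping distinct vertices `u` and `v` is an automorphism of `Γ` iff for every `i ≥ 1`,
`N^i(u) \ {v} = N^i(v) \ {u}`, where `N^i(x) = {y | dist x y = i}`. -/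
theorem swap_isAutomorphism_iff_neighborhoods {V : Type*} [Fintype V] [DecidableEq V]
    (Γ : SimpleGraph V) (hconn : Γ.Connected) (hcard : 2 ≤ Fintype.card V)
    (u v : V) (huv : u ≠ v) :
    (∀ x y : V, Γ.Adj (Equiv.swap u v x) (Equiv.swap u v y) ↔ Γ.Adj x y) ↔
      (∀ i : ℕ, 1 ≤ i →
        {x : V | Γ.dist u x = i} \ {v} = {x : V | Γ.dist v x = i} \ {u}) := by
  constructor
  · intro h i hi
    let f : Γ →g Γ := ⟨Equiv.swap u v, fun {a b} hab => (h a b).2 hab⟩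
    have hle : ∀ x y, Γ.dist (Equiv.swap u v x) (Equiv.swap u v y) ≤ Γ.dist x y := by
      intro x y
      obtain ⟨p, hp⟩ := hconn.exists_walk_length_eq_dist x y
      have := SimpleGraph.dist_le (p.map f)
      rw [SimpleGraph.Walk.length_map, hp] at this
      exact this
    have key : ∀ x, x ≠ u → x ≠ v → Γ.dist u x = Γ.dist v x := by
      intro x hxu hxv
      have h1 := hle u x
      have h2 := hle v x
      rw [Equiv.swap_apply_left, Equiv.swap_apply_of_ne_of_ne hxu hxv] at h1
      rw [Equiv.swap_apply_right, Equiv.swap_apply_of_ne_of_ne hxu hxv] at h2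
      omega
    ext x
    simp only [Set.mem_diff, Set.mem_setOf_eq, Set.mem_singleton_iff]
    by_cases hxu : x = u
    · subst hxu
      simp [SimpleGraph.dist_self]
      omega
    by_cases hxv : x = v
    · subst hxv
      simp [SimpleGraph.dist_self]
      omega
    simp [hxu, hxv, key x hxu hxv]
  · intro h x y
    have key : ∀ x, x ≠ u → x ≠ v → (Γ.Adj u x ↔ Γ.Adj v x) := by
      intro x hxu hxv
      have := Set.ext_iff.1 (h 1 le_rfl) x
      simpa [hxu, hxv, SimpleGraph.dist_eq_one_iff_adj] using this
    simp only [Equiv.swap_apply_def]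
    have hs : ∀ a b, Γ.Adj a b ↔ Γ.Adj b a := fun a b => Γ.adj_comm a b
    have hi : ∀ a, ¬ Γ.Adj a a := fun a => Γ.irrefl
    split_ifs <;> grind
end

section
/- For a simple graph Γ on a finite vertex type V, the relation r on V defined by r u v ↔ (u = v ∨ Equiv.swap u v is an automorphism of Γ) is an equivalence relation (it is reflexive, symmetric, and transitive). -/
/-- Structural equivalence (together with equality) is an
equivalence relation on the vertex set of a simple graph. -/
theorem structurallyEquivalent_equivalence {V : Type*} [Fintype V] [DecidableEq V]
    (Γ : SimpleGraph V) :
    Equivalence (fun u v : V =>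
      u = v ∨ ∀ x y : V, Γ.Adj (Equiv.swap u v x) (Equiv.swap u v y) ↔ Γ.Adj x y) := by
  refine ⟨fun _ => Or.inl rfl, ?_, ?_⟩
  · rintro u v (h | h)
    · exact Or.inl h.symm
    · right
      rw [Equiv.swap_comm]
      exact h
  · rintro u v w (rfl | h1) (rfl | h2)
    · exact Or.inl rfl
    · exact Or.inr h2
    · exact Or.inr h1
    · by_cases huw : w = u
      · exact Or.inl huw.symm
      by_cases hvw : w = v
      · subst hvw
        exact Or.inr h1
      right
      intro x y
      have key := Equiv.swap_mul_swap_mul_swap hvw huw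
      rw [Equiv.swap_comm v u, Equiv.swap_comm w v] at key
      rw [← key]
      simp only [Equiv.Perm.mul_apply]
      rw [h1, h2, h1]
end

section
/- Let Γ be a simple graph on a finite vertex type V and let s : Setoid V be a setoid satisfying s.r u v ↔ (u = v ∨ Equiv.swap u v is an automorphism of Γ). Then the SEP group SEP(Γ) is isomorphic as a group to the direct product over all classes c : Quotient s of the symmetric group on the class, i.e., there is a multiplicative equivalence SEP(Γ) ≃* Π (c : Quotient s), Equiv.Perm {v : V // Quotient.mk s v = c}. -/
/-- The SEP group of a graph: the subgroup of `Equiv.Perm V` generated by the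
transpositions that are automorphisms of `Γ`. -/
def SEP {V : Type*} [Fintype V] [DecidableEq V] (Γ : SimpleGraph V) : Subgroup (Equiv.Perm V) :=
  Subgroup.closure {σ : Equiv.Perm V | ∃ u v : V, u ≠ v ∧ σ = Equiv.swap u v ∧
    ∀ x y : V, Γ.Adj (σ x) (σ y) ↔ Γ.Adj x y}

theorem mem_SEP_iff {V : Type*} [Fintype V] [DecidableEq V] (Γ : SimpleGraph V)
    (s : Setoid V)
    (hs : ∀ u v : V, s.r u v ↔
      (u = v ∨ ∀ x y : V, Γ.Adj (Equiv.swap u v x) (Equiv.swap u v y) ↔ Γ.Adj x y))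
    (σ : Equiv.Perm V) :
    σ ∈ SEP Γ ↔ ∀ v, Quotient.mk s (σ v) = Quotient.mk s v := by
  constructor
  · intro h
    unfold SEP at h
    induction h using Subgroup.closure_induction with
    | mem x hx =>
      obtain ⟨u, v, huv, rfl, ha⟩ := hx
      have h1 : Quotient.mk s u = Quotient.mk s v := Quotient.sound ((hs u v).2 (Or.inr ha))
      intro w
      rw [Equiv.swap_apply_def]
      split_ifs with h2 h3
      · rw [h2, h1]
      · rw [h3, h1]
      · rfl
    | one => intro v; rfl
    | mul x y _ _ hx hy => intro v; rw [Equiv.Perm.mul_apply, hx, hy]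
    | inv x _ hx => intro v; rw [← hx (x⁻¹ v)]; simp
  · intro h
    unfold SEP
    rw [mem_closure_isSwap]
    · refine ⟨Set.toFinite _, fun x => ?_⟩
      have h1 : s.r x (σ x) := Quotient.exact (h x).symm
      by_cases hx : x = σ x
      · rw [← hx]; exact MulAction.mem_orbit_self _
      · have h2 := ((hs _ _).1 h1).resolve_left hx
        refine ⟨⟨Equiv.swap x (σ x), Subgroup.subset_closure ⟨x, σ x, hx, rfl, h2⟩⟩, ?_⟩
        simp [Subgroup.smul_def]
    · rintro f ⟨u, v, huv, rfl, -⟩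
      exact ⟨u, v, huv, rfl⟩

/-- `SEP(Γ)` is isomorphic to the direct product over the structural
equivalence classes of the symmetric groups on the classes. -/
theorem SEP_mulEquiv_pi_perm {V : Type*} [Fintype V] [DecidableEq V] (Γ : SimpleGraph V)
    (s : Setoid V)
    (hs : ∀ u v : V, s.r u v ↔
      (u = v ∨ ∀ x y : V, Γ.Adj (Equiv.swap u v x) (Equiv.swap u v y) ↔ Γ.Adj x y)) :
    Nonempty (SEP Γ ≃* Π c : Quotient s, Equiv.Perm {v : V // Quotient.mk s v = c}) := by
  have key := mem_SEP_iff Γ s hs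
  have aux : ∀ (p : Π c : Quotient s, Equiv.Perm {v : V // Quotient.mk s v = c})
      (c : Quotient s) (w : {v : V // Quotient.mk s v = c}),
      (p (Quotient.mk s w.1) ⟨w.1, rfl⟩).1 = (p c w).1 := by
    rintro p c ⟨w, rfl⟩
    rfl
  let g : SEP Γ →* Π c : Quotient s, Equiv.Perm {v : V // Quotient.mk s v = c} :=
    { toFun := fun σ c => σ.1.subtypePerm (fun v => by rw [(key σ.1).1 σ.2 v])
      map_one' := by ext; rfl
      map_mul' := fun a b => by ext; rfl }
  refine ⟨MulEquiv.ofBijective g ⟨?_, ?_⟩⟩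
  · intro a b hab
    ext v
    exact congrArg Subtype.val (Equiv.congr_fun (congrFun hab (Quotient.mk s v)) ⟨v, rfl⟩)
  · intro p
    let σ : Equiv.Perm V :=
      { toFun := fun v => (p (Quotient.mk s v) ⟨v, rfl⟩).1
        invFun := fun v => ((p (Quotient.mk s v))⁻¹ ⟨v, rfl⟩).1
        left_inv := fun v => by
          have := aux (fun c => (p c)⁻¹) _ (p (Quotient.mk s v) ⟨v, rfl⟩)
          simpa using this
        right_inv := fun v => by
          have := aux p _ ((p (Quotient.mk s v))⁻¹ ⟨v, rfl⟩)
          simpa using this }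
    refine ⟨⟨σ, (key σ).2 fun v => (p (Quotient.mk s v) ⟨v, rfl⟩).2⟩, ?_⟩
    ext c w
    exact aux p c w
end

section
/- Let Γ be a simple graph on a finite vertex type V and let s : Setoid V be a setoid satisfying s.r u v ↔ (u = v ∨ Equiv.swap u v is an automorphism of Γ). Then the order of the SEP group equals the product of the factorials of the sizes of the structural equivalence classes: Nat.card SEP(Γ) = ∏ (c : Quotient s), (Nat.card {v : V // Quotient.mk s v = c})!. -/
/-- the order of `SEP(Γ)` is the product of the factorials of the
sizes of the structural equivalence classes. -/
theorem card_SEP_eq_prod_factorials {V : Type*} [Fintype V] [DecidableEq V]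
    (Γ : SimpleGraph V) (s : Setoid V) [Fintype (Quotient s)]
    (hs : ∀ u v : V, s.r u v ↔
      (u = v ∨ ∀ x y : V, Γ.Adj (Equiv.swap u v x) (Equiv.swap u v y) ↔ Γ.Adj x y)) :
    Nat.card (SEP Γ) = ∏ c : Quotient s, Nat.factorial (Nat.card {v : V // Quotient.mk s v = c}) := by
  classical
  have key : ∀ σ : Equiv.Perm V, σ ∈ SEP Γ ↔ (Quotient.mk s) ∘ σ = Quotient.mk s := by
    intro σ
    constructor
    · intro h
      unfold SEP at h
      induction h using Subgroup.closure_induction with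
      | mem x hx =>
        obtain ⟨u, v, huv, rfl, hx⟩ := hx
        have huv' : s.r u v := (hs u v).2 (Or.inr hx)
        funext a
        simp only [Function.comp_apply]
        apply Quotient.sound
        by_cases h1 : a = u
        · subst h1
          rw [Equiv.swap_apply_left]
          exact s.symm huv'
        · by_cases h2 : a = v
          · subst h2
            rw [Equiv.swap_apply_right]
            exact huv'
          · rw [Equiv.swap_apply_of_ne_of_ne h1 h2]
      | one => rfl
      | mul x y _ _ hx hy =>
        funext a
        have h1 := congrFun hx (y a)
        have h2 := congrFun hy a
        exact h1.trans h2
      | inv x _ hx =>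
        funext a
        have h1 := congrFun hx (x⁻¹ a)
        have h2 : x (x⁻¹ a) = a := Equiv.apply_symm_apply x a
        simp only [Function.comp_apply, h2] at h1 ⊢
        exact h1.symm
    · intro h
      unfold SEP
      refine (mem_closure_isSwap ?_).2 ⟨Set.toFinite _, ?_⟩
      rotate_left
      · intro a
        have hr : s.r a (σ a) := s.symm (Quotient.exact (congrFun h a))
        rcases (hs _ _).1 hr with h1 | h1
        · rw [← h1]
          exact MulAction.mem_orbit_self a
        · by_cases h2 : a = σ a
          · rw [← h2]
            exact MulAction.mem_orbit_self a
          · exact ⟨⟨Equiv.swap a (σ a), Subgroup.subset_closure ⟨a, σ a, h2, rfl, h1⟩⟩,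
              Equiv.swap_apply_left a (σ a)⟩
      · rintro f ⟨u, v, huv, rfl, -⟩
        exact ⟨u, v, huv, rfl⟩
  have h1 : Nat.card (SEP Γ) = Nat.card {g : Equiv.Perm V // (Quotient.mk s) ∘ g = Quotient.mk s} :=
    Nat.card_congr (Equiv.subtypeEquivRight key)
  rw [h1, Nat.card_eq_fintype_card, DomMulAct.stabilizer_card]
  simp only [Nat.card_eq_fintype_card]
end

section
/- (Hereditary property of SEP(Γ), disjoint-cycle part) Let Γ be a simple graph on a finite vertex type V. If σ ∈ SEP(Γ), then for every vertex x : V the cycle of σ at x is again in SEP(Γ), i.e., σ.cycleOf x ∈ SEP(Γ). -/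
/-- Hereditary property, disjoint-cycle part: if `σ ∈ SEP(Γ)` then
every cycle of `σ` is again in `SEP(Γ)`. -/
theorem cycleOf_mem_SEP {V : Type*} [Fintype V] [DecidableEq V] (Γ : SimpleGraph V)
    (σ : Equiv.Perm V) (hσ : σ ∈ SEP Γ) (x : V) :
    σ.cycleOf x ∈ SEP Γ := by
  unfold SEP at hσ ⊢
  rw [mem_closure_isSwap] at hσ ⊢
  · refine ⟨Set.toFinite _, fun y => ?_⟩
    rw [Equiv.Perm.cycleOf_apply]
    split_ifs
    · exact hσ.2 y
    · exact MulAction.mem_orbit_self y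
  · rintro f ⟨u, v, huv, h, -⟩
    exact ⟨u, v, huv, h⟩
  · rintro f ⟨u, v, huv, h, -⟩
    exact ⟨u, v, huv, h⟩
end

section
/- (Hereditary property of SEP(Γ), sub-cycle part) Let Γ be a simple graph on a finite vertex type V. If σ ∈ SEP(Γ) and u ≠ v are two vertices lying in the support of the same cycle of σ (i.e., u, v ∈ (σ.cycleOf x).support for some x : V), then the transposition Equiv.swap u v is an automorphism of Γ, and in particular Equiv.swap u v ∈ SEP(Γ). -/
/-- Hereditary property, sub-cycle part: if `σ ∈ SEP(Γ)` and `u ≠ v`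
lie in the support of the same cycle of `σ`, then `Equiv.swap u v` is an automorphism
of `Γ` and `Equiv.swap u v ∈ SEP(Γ)`. -/
theorem swap_mem_SEP_of_mem_cycle_support {V : Type*} [Fintype V] [DecidableEq V]
    (Γ : SimpleGraph V) (σ : Equiv.Perm V) (hσ : σ ∈ SEP Γ) (u v x : V) (huv : u ≠ v)
    (hu : u ∈ (σ.cycleOf x).support) (hv : v ∈ (σ.cycleOf x).support) :
    (∀ a b : V, Γ.Adj (Equiv.swap u v a) (Equiv.swap u v b) ↔ Γ.Adj a b) ∧
      Equiv.swap u v ∈ SEP Γ := by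
  have haut : ∀ τ ∈ SEP Γ, ∀ a b : V, Γ.Adj (τ a) (τ b) ↔ Γ.Adj a b := by
    intro τ hτ
    unfold SEP at hτ
    induction hτ using Subgroup.closure_induction with
    | mem τ h => obtain ⟨_, _, _, _, h⟩ := h; exact h
    | one => intro a b; rfl
    | mul f g _ _ hf hg => intro a b; rw [Equiv.Perm.mul_apply, Equiv.Perm.mul_apply, hf, hg]
    | inv f _ hf => intro a b; rw [← hf]; simp
  have hmem : Equiv.swap u v ∈ SEP Γ := by
    rw [Equiv.Perm.mem_support_cycleOf_iff] at hu hv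
    obtain ⟨n, hn⟩ := hv.1.symm.trans hu.1
    unfold SEP at hσ ⊢
    rw [swap_mem_closure_isSwap
      (by rintro f ⟨a, b, hab, rfl, _⟩; exact ⟨a, b, hab, rfl⟩)]
    exact ⟨⟨σ ^ n, Subgroup.zpow_mem _ hσ n⟩, hn⟩
  exact ⟨haut _ hmem, hmem⟩
end

section
/- Let p and q be distinct primes and n : ℕ. The symmetric group on n letters contains an element of order p·q if and only if p + q ≤ n; that is, (∃ σ : Equiv.Perm (Fin n), orderOf σ = p * q) ↔ p + q ≤ n. -/
theorem aux_dvd_lcm (r : ℕ) (hr : r.Prime) (m : Multiset ℕ) (h : r ∣ m.lcm) : ∃ a ∈ m, r ∣ a := by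
  induction m using Multiset.induction_on with
  | empty => simp at h; exact absurd h hr.one_lt.ne'
  | cons a s ih =>
    rw [Multiset.lcm_cons] at h
    have h2 : r ∣ a * s.lcm := h.trans (lcm_dvd (Dvd.intro _ rfl) (Dvd.intro_left _ rfl))
    rcases hr.dvd_mul.1 h2 with h3 | h3
    · exact ⟨a, Multiset.mem_cons_self _ _, h3⟩
    · obtain ⟨b, hb, hb'⟩ := ih h3
      exact ⟨b, Multiset.mem_cons_of_mem hb, hb'⟩

/-- for distinct primes `p` and `q`, the symmetric group on `n` letters
has an element of order `p * q` iff `p + q ≤ n`. -/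
theorem exists_perm_orderOf_eq_mul_iff (p q n : ℕ) (hp : p.Prime) (hq : q.Prime)
    (hpq : p ≠ q) :
    (∃ σ : Equiv.Perm (Fin n), orderOf σ = p * q) ↔ p + q ≤ n := by
  have hc : Nat.Coprime p q := (Nat.coprime_primes hp hq).2 hpq
  constructor
  · rintro ⟨σ, hσ⟩
    rw [← Equiv.Perm.lcm_cycleType] at hσ
    obtain ⟨a, ha, hpa⟩ := aux_dvd_lcm p hp σ.cycleType (hσ ▸ Dvd.intro _ rfl)
    obtain ⟨b, hb, hqb⟩ := aux_dvd_lcm q hq σ.cycleType (hσ ▸ Dvd.intro_left _ rfl)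
    have ha2 := Equiv.Perm.two_le_of_mem_cycleType ha
    have hb2 := Equiv.Perm.two_le_of_mem_cycleType hb
    have hs : σ.cycleType.sum ≤ n := by
      rw [Equiv.Perm.sum_cycleType]
      simpa using Finset.card_le_univ σ.support
    obtain ⟨t, ht⟩ := Multiset.exists_cons_of_mem ha
    rw [ht, Multiset.sum_cons] at hs
    by_cases hab : b = a
    · subst hab
      have h1 := Nat.le_of_dvd (by omega) (hc.mul_dvd_of_dvd_of_dvd hpa hqb)
      have h4 : p + q ≤ p * q := Nat.add_le_mul hp.two_le hq.two_le
      omega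
    · rw [ht] at hb
      have hbt := (Multiset.mem_cons.1 hb).resolve_left hab
      have h1 := Multiset.le_sum_of_mem hbt
      have h2 := Nat.le_of_dvd (by omega) hpa
      have h3 := Nat.le_of_dvd (by omega) hqb
      omega
  · intro h
    obtain ⟨σ, hσ⟩ := (Equiv.Perm.exists_with_cycleType_iff (α := Fin n) (m := {p, q})).2
      ⟨by simpa using h, by simp [hp.two_le, hq.two_le]⟩
    refine ⟨σ, ?_⟩
    rw [← Equiv.Perm.lcm_cycleType, hσ]
    have h1 : Multiset.lcm ({p, q} : Multiset ℕ) = Nat.lcm p q := by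
      simp
      rfl
    rw [h1, hc.lcm_eq_mul]
end

section
/- Let ι be a finite index type, γ : ι → ℕ, and let p, q be distinct primes. The direct product G = Π (i : ι), Equiv.Perm (Fin (γ i)) contains an element of order p·q if and only if either some factor has γ i ≥ p + q, or there are two distinct indices i ≠ j with p ≤ γ i and q ≤ γ j. Formally: (∃ g : Π i, Equiv.Perm (Fin (γ i)), orderOf g = p * q) ↔ ((∃ i, p + q ≤ γ i) ∨ (∃ i j, i ≠ j ∧ p ≤ γ i ∧ q ≤ γ j)). -/
theorem aux_dvd (m : Multiset ℕ) (p : ℕ) (hp : p.Prime) (h : p ∣ m.lcm) : ∃ a ∈ m, p ∣ a := by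
  have h2 : p ∣ m.prod := h.trans (Multiset.lcm_dvd.2 fun b hb => Multiset.dvd_prod hb)
  exact hp.prime.exists_mem_multiset_dvd h2

theorem aux_cyc {n p : ℕ} (hp : p.Prime) (σ : Equiv.Perm (Fin n)) (h : p ∣ orderOf σ) :
    ∃ a ∈ σ.cycleType, p ∣ a ∧ 2 ≤ a := by
  rw [← Equiv.Perm.lcm_cycleType] at h
  obtain ⟨a, ha, hpa⟩ := aux_dvd _ p hp h
  exact ⟨a, ha, hpa, Equiv.Perm.two_le_of_mem_cycleType ha⟩

theorem aux_ex {n : ℕ} (m : Multiset ℕ) (h : m.sum ≤ n) (h2 : ∀ a ∈ m, 2 ≤ a) :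
    ∃ σ : Equiv.Perm (Fin n), orderOf σ = m.lcm := by
  obtain ⟨σ, hσ⟩ := (Equiv.Perm.exists_with_cycleType_iff (Fin n) (m := m)).2
    ⟨by simpa using h, h2⟩
  exact ⟨σ, by rw [← Equiv.Perm.lcm_cycleType, hσ]⟩

/-- for distinct primes `p`, `q`, a finite direct product of symmetric
groups `Π i, S_{γ i}` has an element of order `p * q` iff some factor has
`γ i ≥ p + q`, or two distinct factors have `γ i ≥ p` and `γ j ≥ q`. -/
theorem exists_pi_perm_orderOf_eq_mul_iff {ι : Type*} [Fintype ι] (γ : ι → ℕ)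
    (p q : ℕ) (hp : p.Prime) (hq : q.Prime) (hpq : p ≠ q) :
    (∃ g : Π i : ι, Equiv.Perm (Fin (γ i)), orderOf g = p * q) ↔
      ((∃ i, p + q ≤ γ i) ∨ (∃ i j, i ≠ j ∧ p ≤ γ i ∧ q ≤ γ j)) := by
  classical
  have hcop : p.Coprime q := (Nat.coprime_primes hp hq).2 hpq
  constructor
  · rintro ⟨g, hg⟩
    have key : ∀ r : ℕ, r.Prime → r ∣ p * q → ∃ i, ∃ a ∈ (g i).cycleType, r ∣ a ∧ 2 ≤ a := by
      intro r hr hd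
      rw [← hg, Pi.orderOf] at hd
      obtain ⟨a, ha, hra⟩ := aux_dvd _ r hr hd
      obtain ⟨i, -, rfl⟩ := Multiset.mem_map.1 ha
      exact ⟨i, aux_cyc hr _ hra⟩
    have hsum : ∀ i, (g i).cycleType.sum ≤ γ i := fun i => by
      simpa using Equiv.Perm.sum_cycleType_le (g i)
    obtain ⟨i, a, ha, hpa, ha2⟩ := key p hp (dvd_mul_right _ _)
    obtain ⟨j, b, hb, hqb, hb2⟩ := key q hq (dvd_mul_left _ _)
    have hpa' := Nat.le_of_dvd (by omega) hpa
    have hqb' := Nat.le_of_dvd (by omega) hqb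
    by_cases hij : i = j
    · subst hij
      left
      refine ⟨i, le_trans ?_ (hsum i)⟩
      by_cases hab : a = b
      · subst hab
        have h1 := Nat.le_of_dvd (by omega) (hcop.mul_dvd_of_dvd_of_dvd hpa hqb)
        have h2 := Multiset.le_sum_of_mem ha
        have := hp.two_le
        have := hq.two_le
        nlinarith
      · obtain ⟨t, ht⟩ := Multiset.exists_cons_of_mem ha
        rw [ht] at hb ⊢
        have hb' : b ∈ t := (Multiset.mem_cons.1 hb).resolve_left (Ne.symm hab)
        have h2 := Multiset.le_sum_of_mem hb'
        rw [Multiset.sum_cons]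
        omega
    · right
      exact ⟨i, j, hij, hpa'.trans ((Multiset.le_sum_of_mem ha).trans (hsum i)),
        hqb'.trans ((Multiset.le_sum_of_mem hb).trans (hsum j))⟩
  · have hs : ∀ (i : ι) (σ : Equiv.Perm (Fin (γ i))),
        orderOf (Pi.mulSingle i σ : Π i : ι, Equiv.Perm (Fin (γ i))) = orderOf σ := fun i σ =>
      orderOf_injective (MonoidHom.mulSingle (fun i => Equiv.Perm (Fin (γ i))) i)
        (Pi.mulSingle_injective (M := fun i => Equiv.Perm (Fin (γ i))) i) σ
    rintro (⟨i, hi⟩ | ⟨i, j, hij, hi, hj⟩)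
    · obtain ⟨σ, hσ⟩ := aux_ex (n := γ i) {p, q} (by simpa using hi)
        (by simp [hp.two_le, hq.two_le])
      refine ⟨Pi.mulSingle i σ, ?_⟩
      rw [hs, hσ, ← hcop.lcm_eq_mul]
      simp [Multiset.insert_eq_cons, GCDMonoid.lcm]
    · obtain ⟨σ, hσ⟩ := aux_ex (n := γ i) {p} (by simpa using hi) (by simp [hp.two_le])
      obtain ⟨τ, hτ⟩ := aux_ex (n := γ j) {q} (by simpa using hj) (by simp [hq.two_le])
      simp at hσ hτ
      refine ⟨Pi.mulSingle i σ * Pi.mulSingle j τ, ?_⟩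
      rw [Commute.orderOf_mul_eq_mul_orderOf_of_coprime (Pi.mulSingle_commute (f := fun i => Equiv.Perm (Fin (γ i))) hij σ τ), hs, hs,
        hσ, hτ]
      rwa [hs, hs, hσ, hτ]
end

section
/- Let α, β, k : ℕ with 1 ≤ β ≤ α and k ≥ 2, and let pₘ = Nat.nth Nat.Prime m denote the (m+1)-st prime (so p₀ = 2). In the group G = Equiv.Perm (Fin α) × Equiv.Perm (Fin β), the prime graph contains a k-clique on the first k primes, i.e., (∀ i j : ℕ, i < j → j < k → ∃ g : G, orderOf g = pᵢ * pⱼ), if and only if p₍ₖ₋₁₎ + p₍ₖ₋₂₎ ≤ α or (p₍ₖ₋₁₎ ≤ α and p₍ₖ₋₂₎ ≤ β). -/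
theorem aux_le {n p : ℕ} (hp : p.Prime) (σ : Equiv.Perm (Fin n)) (h : p ∣ orderOf σ) : p ≤ n := by
  have h1 : p ∣ n.factorial := by
    have := orderOf_dvd_card (x := σ)
    rw [Fintype.card_perm, Fintype.card_fin] at this
    exact h.trans this
  exact (Nat.Prime.dvd_factorial hp).1 h1

theorem aux_dvd_lcm_s9 {p : ℕ} (hp : p.Prime) (m : Multiset ℕ) (h : p ∣ m.lcm) :
    ∃ c ∈ m, p ∣ c := by
  induction m using Multiset.induction_on with
  | empty => simp at h; exact absurd h hp.one_lt.ne'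
  | cons a s ih =>
    rw [Multiset.lcm_cons] at h
    have h2 : p ∣ a * s.lcm := h.trans (lcm_dvd_mul _ _)
    rcases hp.dvd_mul.1 h2 with h3 | h3
    · exact ⟨a, by simp, h3⟩
    · obtain ⟨c, hc, hd⟩ := ih h3
      exact ⟨c, by simp [hc], hd⟩

theorem aux_add_le {n p q : ℕ} (hp : p.Prime) (hq : q.Prime) (hpq : p ≠ q)
    (σ : Equiv.Perm (Fin n)) (h : p ∣ orderOf σ) (h' : q ∣ orderOf σ) : p + q ≤ n := by
  have hs : σ.cycleType.sum ≤ n := by simpa using σ.sum_cycleType_le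
  have hpos : ∀ c ∈ σ.cycleType, 0 < c := fun c hc =>
    lt_trans one_pos (Equiv.Perm.one_lt_of_mem_cycleType hc)
  rw [← Equiv.Perm.lcm_cycleType] at h h'
  obtain ⟨c, hc, hpc⟩ := aux_dvd_lcm_s9 hp _ h
  obtain ⟨d, hd, hqd⟩ := aux_dvd_lcm_s9 hq _ h'
  by_cases hcd : c = d
  · subst hcd
    have h1 : p * q ∣ c := Nat.Coprime.mul_dvd_of_dvd_of_dvd
      ((Nat.coprime_primes hp hq).2 hpq) hpc hqd
    have h2 := Nat.le_of_dvd (hpos c hc) h1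
    have h3 := Multiset.le_sum_of_mem hc
    have := hp.two_le
    have := hq.two_le
    nlinarith
  · obtain ⟨t, ht⟩ := Multiset.exists_cons_of_mem hc
    have hd2 : d ∈ t := by
      rw [ht, Multiset.mem_cons] at hd
      exact hd.resolve_left (Ne.symm hcd)
    have h3 := Multiset.le_sum_of_mem hd2
    have h4 := Nat.le_of_dvd (hpos c hc) hpc
    have h5 := Nat.le_of_dvd (hpos d hd) hqd
    rw [ht, Multiset.sum_cons] at hs
    omega

theorem aux_exists_one {n p : ℕ} (hp : p.Prime) (h : p ≤ n) :
    ∃ σ : Equiv.Perm (Fin n), orderOf σ = p := by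
  obtain ⟨σ, hσ⟩ := (Equiv.Perm.exists_with_cycleType_iff (Fin n) (m := {p})).2
    ⟨by simpa using h, by simpa using hp.two_le⟩
  exact ⟨σ, by rw [← Equiv.Perm.lcm_cycleType, hσ]; simp⟩

theorem aux_exists_two {n p q : ℕ} (hp : p.Prime) (hq : q.Prime) (hpq : p ≠ q) (h : p + q ≤ n) :
    ∃ σ : Equiv.Perm (Fin n), orderOf σ = p * q := by
  obtain ⟨σ, hσ⟩ := (Equiv.Perm.exists_with_cycleType_iff (Fin n) (m := {p, q})).2
    ⟨by simpa using h, by simpa using ⟨hp.two_le, hq.two_le⟩⟩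
  refine ⟨σ, ?_⟩
  rw [← Equiv.Perm.lcm_cycleType, hσ]
  have := ((Nat.coprime_primes hp hq).2 hpq).lcm_eq_mul
  rw [← this]
  simp [lcm_eq_nat_lcm]

/-- for `1 ≤ β ≤ α` and `k ≥ 2`, the prime graph of
`S_α × S_β` contains a `k`-clique on the first `k` primes iff
`p_{k-1} + p_{k-2} ≤ α` or (`p_{k-1} ≤ α` and `p_{k-2} ≤ β`),
where `p_m = Nat.nth Nat.Prime m`. -/
theorem primeGraph_k_clique_iff (α β k : ℕ) (hβ : 1 ≤ β) (hβα : β ≤ α) (hk : 2 ≤ k) :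
    (∀ i j : ℕ, i < j → j < k →
        ∃ g : Equiv.Perm (Fin α) × Equiv.Perm (Fin β),
          orderOf g = Nat.nth Nat.Prime i * Nat.nth Nat.Prime j) ↔
      (Nat.nth Nat.Prime (k - 1) + Nat.nth Nat.Prime (k - 2) ≤ α ∨
        (Nat.nth Nat.Prime (k - 1) ≤ α ∧ Nat.nth Nat.Prime (k - 2) ≤ β)) := by
  have pr : ∀ i, (Nat.nth Nat.Prime i).Prime := Nat.prime_nth_prime
  have mono : StrictMono (Nat.nth Nat.Prime) := Nat.nth_strictMono Nat.infinite_setOf_prime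
  constructor
  · intro H
    obtain ⟨⟨a, b⟩, hg⟩ := H (k - 2) (k - 1) (by omega) (by omega)
    have hlt : Nat.nth Nat.Prime (k - 2) < Nat.nth Nat.Prime (k - 1) := mono (by omega)
    have hp := pr (k - 2)
    have hq := pr (k - 1)
    generalize Nat.nth Nat.Prime (k - 2) = p at *
    generalize Nat.nth Nat.Prime (k - 1) = q at *
    rw [Prod.orderOf_mk] at hg
    have key : ∀ r : ℕ, r.Prime → r ∣ p * q → r ∣ orderOf a ∨ r ∣ orderOf b := by
      intro r hr hd
      rw [← hg] at hd
      exact hr.dvd_mul.1 (hd.trans (Nat.lcm_dvd_mul _ _))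
    rcases key p hp (dvd_mul_right _ _) with h1 | h1 <;>
      rcases key q hq (dvd_mul_left _ _) with h2 | h2
    · left; have := aux_add_le hp hq hlt.ne a h1 h2; omega
    · right; have := aux_le hq b h2; omega
    · right; exact ⟨aux_le hq a h2, aux_le hp b h1⟩
    · left; have := aux_add_le hp hq hlt.ne b h1 h2; omega
  · intro H i j hij hj
    have hi' := mono.monotone (show i ≤ k - 2 by omega)
    have hj' := mono.monotone (show j ≤ k - 1 by omega)
    have hne := (mono hij).ne
    rcases H with H | ⟨H1, H2⟩
    · obtain ⟨σ, hσ⟩ := aux_exists_two (n := α) (pr i) (pr j) hne (by omega)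
      exact ⟨(σ, 1), by rw [Prod.orderOf_mk, hσ]; simp⟩
    · obtain ⟨σ, hσ⟩ := aux_exists_one (n := α) (pr j) (by omega)
      obtain ⟨τ, hτ⟩ := aux_exists_one (n := β) (pr i) (by omega)
      refine ⟨(σ, τ), ?_⟩
      rw [Prod.orderOf_mk, hσ, hτ, Nat.lcm_comm]
      exact ((Nat.coprime_primes (pr i) (pr j)).2 hne).lcm_eq_mul
end

section
/- Let α, β, n : ℕ with 1 ≤ β ≤ α and n ≥ 2, let G = Equiv.Perm (Fin α) × Equiv.Perm (Fin β), and let pₘ = Nat.nth Nat.Prime m denote the (m+1)-st prime (so p₀ = 2). Then the prime graph of G is the complete graph on n vertices — i.e., the set {p : ℕ | p.Prime ∧ p ∣ Nat.card G} has exactly n elements and for every two distinct primes p ≠ q in this set there exists g : G with orderOf g = p * q — if and only if p₍ₙ₋₁₎ ≤ α < pₙ and p₍ₙ₋₂₎ ≤ β. -/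
theorem pg_real_ineq {x : ℝ} (x_large : (2048 : ℝ) ≤ x) :
    x * (2 * x) ^ √(2 * x) * 4 ^ (2 * x / 3) * (2 * x) ≤ 4 ^ x := by
  have h5 : 0 < x := lt_of_lt_of_le (by norm_num1) x_large
  let f : ℝ → ℝ := fun x => Real.log x + Real.log x + √(2 * x) * Real.log (2 * x)
    - Real.log 4 / 3 * x
  have h : ConcaveOn ℝ (Set.Ioi 0.5) f := by
    have hl : ConcaveOn ℝ (Set.Ioi 0.5) Real.log :=
      strictConcaveOn_log_Ioi.concaveOn.subset
          (Set.Ioi_subset_Ioi (by norm_num)) (convex_Ioi 0.5)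
    apply ConcaveOn.sub
    · apply ConcaveOn.add
      · exact hl.add hl
      convert!
        ((strictConcaveOn_sqrt_mul_log_Ioi.concaveOn.comp_linearMap ((2 : ℝ) • LinearMap.id)))
        using 1
      ext x
      simp only [Set.mem_Ioi, Set.mem_preimage, LinearMap.smul_apply,
        LinearMap.id_coe, id_eq, smul_eq_mul]
      rw [← mul_lt_mul_iff_right₀ (two_pos)]
      norm_num1
      rfl
    apply ConvexOn.smul
    · refine div_nonneg (Real.log_nonneg (by norm_num1)) (by norm_num1)
    · exact convexOn_id (convex_Ioi (0.5 : ℝ))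
  have hl2 : 0 < Real.log 2 := Real.log_pos (by norm_num)
  have l4 : Real.log 4 = 2 * Real.log 2 := by
    rw [show (4 : ℝ) = 2 ^ 2 by norm_num, Real.log_pow]; norm_num
  have f1 : -Real.log 2 ≤ f 8 := by
    have : √(2 * 8 : ℝ) = 4 :=
      (Real.sqrt_eq_iff_mul_self_eq_of_pos (by norm_num1)).mpr (by norm_num1)
    have e1 : Real.log 8 = 3 * Real.log 2 := by
      rw [show (8 : ℝ) = 2 ^ 3 by norm_num, Real.log_pow]; norm_num
    have e2 : Real.log (2 * 8) = 4 * Real.log 2 := by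
      rw [show (2 * 8 : ℝ) = 2 ^ 4 by norm_num, Real.log_pow]; norm_num
    simp only [f, this, e1, e2, l4]
    linarith
  have f2 : f 2048 ≤ -Real.log 2 := by
    have : √(2 * 2048 : ℝ) = 64 :=
      (Real.sqrt_eq_iff_mul_self_eq_of_pos (by norm_num1)).mpr (by norm_num1)
    have e1 : Real.log 2048 = 11 * Real.log 2 := by
      rw [show (2048 : ℝ) = 2 ^ 11 by norm_num, Real.log_pow]; norm_num
    have e2 : Real.log (2 * 2048) = 12 * Real.log 2 := by
      rw [show (2 * 2048 : ℝ) = 2 ^ 12 by norm_num, Real.log_pow]; norm_num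
    simp only [f, this, e1, e2, l4]
    linarith
  have fx : f x ≤ -Real.log 2 := by
    have h1 : (0.5 : ℝ) < 8 := by norm_num
    exact (h.right_le_of_le_left'' (y := 2048) (x := 8) h1
      (show (0.5 : ℝ) < x by linarith) (by norm_num) x_large (f2.trans f1)).trans f2
  have h6 : 0 < 2 * x := by linarith
  rw [← Real.log_le_log_iff (by positivity) (by positivity),
    Real.log_mul (by positivity) (by positivity), Real.log_mul (by positivity) (by positivity),
    Real.log_mul (by positivity) (by positivity), Real.log_rpow h6, Real.log_rpow (by norm_num),
    Real.log_rpow (by norm_num)]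
  have e3 : Real.log (2 * x) = Real.log 2 + Real.log x :=
    Real.log_mul (by norm_num) h5.ne'
  simp only [f] at fx
  nlinarith [fx, e3]

theorem pg_nat_ineq {n : ℕ} (n_large : 2048 ≤ n) :
    n * (2 * n) ^ Nat.sqrt (2 * n) * 4 ^ (2 * n / 3) * (2 * n) ≤ 4 ^ n := by
  rw [← @Nat.cast_le ℝ]
  simp only [Nat.cast_mul, Nat.cast_pow, ← Real.rpow_natCast, Nat.cast_ofNat]
  refine _root_.trans ?_ (pg_real_ineq (by exact_mod_cast n_large))
  gcongr
  · have n2_pos : 1 ≤ 2 * n := by omega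
    exact mod_cast n2_pos
  · exact_mod_cast Real.nat_sqrt_le_real_sqrt
  · norm_num1
  · exact Nat.cast_div_le.trans (by norm_cast)

theorem pg_centralBinom_le (n r : ℕ) (n_large : 2 < n) (hr : n < r)
    (no_prime : ∀ p : ℕ, p.Prime → n < p → p ≤ 2 * n → p = r) (hr2 : r ≤ 2 * n) :
    Nat.centralBinom n ≤ (2 * n) ^ Nat.sqrt (2 * n) * 4 ^ (2 * n / 3) * (2 * n) := by
  have n_pos : 0 < n := (Nat.zero_le _).trans_lt n_large
  have n2_pos : 1 ≤ 2 * n := by omega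
  let S := {p ∈ Finset.range (2 * n / 3 + 1) | Nat.Prime p}
  let f x := x ^ n.centralBinom.factorization x
  have hfle : ∀ p, f p ≤ 2 * n := fun p => Nat.pow_factorization_choose_le (by omega)
  have hrS : r ∉ S := by simp [S]; omega
  have key : Nat.centralBinom n = f r * ∏ x ∈ S, f x := by
    rw [← Finset.prod_insert hrS]
    refine (Eq.trans ?_ n.prod_pow_factorization_centralBinom).symm
    apply Finset.prod_subset
    · intro x hx
      simp only [S, Finset.mem_insert, Finset.mem_filter, Finset.mem_range] at hx ⊢
      omega
    intro x hx h2x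
    simp only [S, Finset.mem_insert, Finset.mem_filter, Finset.mem_range, not_or, not_and] at hx h2x
    change x ^ n.centralBinom.factorization x = 1
    by_cases hxp : x.Prime
    · by_cases hxn : x ≤ n
      · have : 2 * n < 3 * x := by
          by_contra hc
          exact h2x.2 (by omega) hxp
        rw [Nat.factorization_centralBinom_of_two_mul_self_lt_three_mul n_large hxn this,
          Nat.pow_zero]
      · exact absurd (no_prime x hxp (by omega) (by omega)) h2x.1
    · rw [Nat.factorization_eq_zero_of_not_prime n.centralBinom hxp, Nat.pow_zero]
  rw [key, mul_comm]
  refine Nat.mul_le_mul ?_ (hfle r)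
  rw [← Finset.prod_filter_mul_prod_filter_not S (· ≤ Nat.sqrt (2 * n))]
  apply mul_le_mul'
  · refine (Finset.prod_le_prod' fun p _ => hfle p).trans ?_
    have : (Finset.Icc 1 (Nat.sqrt (2 * n))).card = Nat.sqrt (2 * n) := by
      rw [Nat.card_Icc, Nat.add_sub_cancel]
    rw [Finset.prod_const]
    refine pow_right_mono₀ n2_pos ((Finset.card_le_card fun x hx => ?_).trans this.le)
    obtain ⟨h1, h2⟩ := Finset.mem_filter.1 hx
    exact Finset.mem_Icc.mpr ⟨(Finset.mem_filter.1 h1).2.one_lt.le, h2⟩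
  · refine le_trans ?_ (primorial_le_four_pow (2 * n / 3))
    refine (Finset.prod_le_prod' fun p hp => (?_ : f p ≤ p)).trans ?_
    · obtain ⟨h1, h2⟩ := Finset.mem_filter.1 hp
      refine (pow_right_mono₀ (Finset.mem_filter.1 h1).2.one_lt.le ?_).trans (pow_one p).le
      exact Nat.factorization_choose_le_one (Nat.sqrt_lt'.mp <| not_le.1 h2)
    refine Finset.prod_le_prod_of_subset_of_one_le' (Finset.filter_subset _ _) ?_
    exact fun p hp _ => (Finset.mem_filter.1 hp).2.one_lt.le

/-- two primes in `(n, 2n]` -/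
theorem pg_two_primes (n : ℕ) (hn : 6 ≤ n) :
    ∃ p r : ℕ, p.Prime ∧ r.Prime ∧ n < p ∧ p < r ∧ r ≤ 2 * n := by
  by_cases hl : 2048 ≤ n
  · obtain ⟨r, hrp, hr1, hr2⟩ := Nat.exists_prime_lt_and_le_two_mul n (by omega)
    by_contra hno
    have h1 := pg_centralBinom_le n r (by omega) hr1 (by
      intro p hp h1 h2
      by_contra hne
      rcases lt_or_gt_of_ne hne with h | h
      · exact hno ⟨p, r, hp, hrp, h1, h, hr2⟩
      · exact hno ⟨r, p, hrp, hp, hr1, h, h2⟩) hr2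
    have h2 := Nat.four_pow_lt_mul_centralBinom n (by omega)
    have h3 := pg_nat_ineq hl
    have h4 := Nat.mul_le_mul_left n h1
    have : n * ((2 * n) ^ Nat.sqrt (2 * n) * 4 ^ (2 * n / 3) * (2 * n)) =
      n * (2 * n) ^ Nat.sqrt (2 * n) * 4 ^ (2 * n / 3) * (2 * n) := by ring
    omega
  · rcases (by omega : n < 7 ∨ (7 ≤ n ∧ n < 11) ∨ (11 ≤ n ∧ n < 17) ∨ (17 ≤ n ∧ n < 29) ∨
      (29 ≤ n ∧ n < 47) ∨ (47 ≤ n ∧ n < 83) ∨ (83 ≤ n ∧ n < 157) ∨ (157 ≤ n ∧ n < 307) ∨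
      (307 ≤ n ∧ n < 601) ∨ (601 ≤ n ∧ n < 1193) ∨ (1193 ≤ n ∧ n < 2081)) with
      h | h | h | h | h | h | h | h | h | h | h
    · exact ⟨7, 11, by norm_num, by norm_num, by omega, by omega, by omega⟩
    · exact ⟨11, 13, by norm_num, by norm_num, by omega, by omega, by omega⟩
    · exact ⟨17, 19, by norm_num, by norm_num, by omega, by omega, by omega⟩
    · exact ⟨29, 31, by norm_num, by norm_num, by omega, by omega, by omega⟩
    · exact ⟨47, 53, by norm_num, by norm_num, by omega, by omega, by omega⟩
    · exact ⟨83, 89, by norm_num, by norm_num, by omega, by omega, by omega⟩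
    · exact ⟨157, 163, by norm_num, by norm_num, by omega, by omega, by omega⟩
    · exact ⟨307, 311, by norm_num, by norm_num, by omega, by omega, by omega⟩
    · exact ⟨601, 607, by norm_num, by norm_num, by omega, by omega, by omega⟩
    · exact ⟨1193, 1201, by norm_num, by norm_num, by omega, by omega, by omega⟩
    · exact ⟨2081, 2083, by norm_num, by norm_num, by omega, by omega, by omega⟩

theorem pg_exists_third (q p : ℕ) (hq : q.Prime) (hp : p.Prime) (hqp : q < p)
    (hcons : ∀ r, r.Prime → q < r → p ≤ r) : ∃ r, r.Prime ∧ p < r ∧ r ≤ p + q := by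
  by_cases h6 : 6 ≤ q
  · obtain ⟨a, b, ha, hb, h1, h2, h3⟩ := pg_two_primes q h6
    have := hcons a ha h1
    exact ⟨b, hb, by omega, by omega⟩
  · have h2 := hq.two_le
    have : q = 2 ∨ q = 3 ∨ q = 5 := by
      interval_cases q <;> first | omega | (exact absurd hq (by norm_num))
    rcases this with rfl | rfl | rfl
    · have := hcons 3 (by norm_num) (by norm_num)
      exact ⟨5, by norm_num, by omega, by omega⟩
    · have := hcons 5 (by norm_num) (by norm_num)
      have : p ≠ 4 := by rintro rfl; exact absurd hp (by norm_num)
      exact ⟨7, by norm_num, by omega, by omega⟩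
    · have := hcons 7 (by norm_num) (by norm_num)
      exact ⟨11, by norm_num, by omega, by omega⟩

theorem pg_nth_le (m : ℕ) : Nat.nth Nat.Prime (m + 2) ≤
    Nat.nth Nat.Prime (m + 1) + Nat.nth Nat.Prime m := by
  have hinf : (Set.ofPred Nat.Prime).Infinite := Nat.infinite_setOfPred_prime
  have hmono := Nat.nth_strictMono hinf
  have hnext : ∀ k r, r.Prime → Nat.nth Nat.Prime k < r → Nat.nth Nat.Prime (k + 1) ≤ r := by
    intro k r hr hlt
    rw [← Nat.nth_count hr] at hlt ⊢
    exact hmono.monotone (hmono.lt_iff_lt.1 hlt)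
  obtain ⟨r, hr, h1, h2⟩ := pg_exists_third _ _ (Nat.prime_nth_prime m) (Nat.prime_nth_prime (m + 1))
    (hmono (Nat.lt_succ_self m)) (hnext m)
  exact (hnext (m + 1) r hr h1).trans h2

theorem pg_perm_order {k p q : ℕ} (hp : p.Prime) (hq : q.Prime) (hpq : p ≠ q)
    (σ : Equiv.Perm (Fin k)) (hpo : p ∣ orderOf σ) (hqo : q ∣ orderOf σ) : p + q ≤ k := by
  have hex : ∀ r : ℕ, r.Prime → r ∣ orderOf σ → ∃ c ∈ σ.cycleType, r ∣ c := by
    intro r hr hd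
    rw [← Equiv.Perm.lcm_cycleType] at hd
    by_contra! hno
    have hgen : ∀ s : Multiset ℕ, (∀ c ∈ s, ¬ r ∣ c) → ¬ r ∣ s.lcm := by
      intro s
      induction s using Multiset.induction with
      | empty => intro _; simpa using hr.one_lt.ne'
      | cons a s ih =>
        intro h hd
        rw [Multiset.lcm_cons] at hd
        have : r ∣ a * s.lcm := hd.trans (lcm_dvd (dvd_mul_right _ _) (dvd_mul_left _ _))
        rcases hr.dvd_mul.1 this with h1 | h1
        · exact h a (by simp) h1
        · exact ih (fun c hc => h c (by simp [hc])) h1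
    exact hgen _ hno hd
  obtain ⟨c, hc, hpc⟩ := hex p hp hpo
  obtain ⟨d, hd, hqd⟩ := hex q hq hqo
  have hsum := Equiv.Perm.sum_cycleType_le σ
  rw [Fintype.card_fin] at hsum
  have hc0 : 0 < c := (Equiv.Perm.one_lt_of_mem_cycleType hc).le
  have hd0 : 0 < d := (Equiv.Perm.one_lt_of_mem_cycleType hd).le
  obtain ⟨s, hs⟩ := Multiset.exists_cons_of_mem hc
  rw [hs] at hsum hd
  rw [Multiset.sum_cons] at hsum
  rcases Multiset.mem_cons.1 hd with rfl | hds
  · have h1 : p * q ∣ d := ((Nat.coprime_primes hp hq).2 hpq).mul_dvd_of_dvd_of_dvd hpc hqd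
    have h2 := Nat.le_of_dvd hd0 h1
    have := hp.two_le
    have := hq.two_le
    have h3 : p + q ≤ p * q := Nat.add_le_mul (by assumption) (by assumption)
    have h4 := h3.trans h2
    exact h4.trans ((Nat.le_add_right _ _).trans hsum)
  · have h1 := Multiset.le_sum_of_mem hds
    have := Nat.le_of_dvd hc0 hpc
    have := Nat.le_of_dvd hd0 hqd
    omega

theorem pg_exists_order {k p : ℕ} (hp : p.Prime) (h : p ≤ k) :
    ∃ σ : Equiv.Perm (Fin k), orderOf σ = p := by
  haveI := Fact.mk hp
  apply exists_prime_orderOf_dvd_card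
  rw [Fintype.card_perm, Fintype.card_fin]
  exact hp.dvd_factorial.2 h

theorem pg_order_le {k p : ℕ} (hp : p.Prime) (σ : Equiv.Perm (Fin k)) (h : p ∣ orderOf σ) :
    p ≤ k := by
  have := h.trans (orderOf_dvd_card (x := σ))
  rw [Fintype.card_perm, Fintype.card_fin] at this
  exact hp.dvd_factorial.1 this

theorem primeGraph_complete_iff (α β n : ℕ) (hβ : 1 ≤ β) (hβα : β ≤ α) (hn : 2 ≤ n) :
    (({p : ℕ | p.Prime ∧ p ∣ Nat.card (Equiv.Perm (Fin α) × Equiv.Perm (Fin β))}.ncard = n) ∧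
      (∀ p q : ℕ,
        p ∈ {p : ℕ | p.Prime ∧ p ∣ Nat.card (Equiv.Perm (Fin α) × Equiv.Perm (Fin β))} →
        q ∈ {p : ℕ | p.Prime ∧ p ∣ Nat.card (Equiv.Perm (Fin α) × Equiv.Perm (Fin β))} →
        p ≠ q →
        ∃ g : Equiv.Perm (Fin α) × Equiv.Perm (Fin β), orderOf g = p * q)) ↔
      (Nat.nth Nat.Prime (n - 1) ≤ α ∧ α < Nat.nth Nat.Prime n ∧
        Nat.nth Nat.Prime (n - 2) ≤ β) := by
  have hset : {p : ℕ | p.Prime ∧ p ∣ Nat.card (Equiv.Perm (Fin α) × Equiv.Perm (Fin β))} =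
      ((Nat.primesBelow (α + 1) : Finset ℕ) : Set ℕ) := by
    ext p
    simp only [Set.mem_ofPred_eq, Nat.card_prod, Nat.card_perm, Nat.card_fin, Finset.mem_coe,
      Nat.mem_primesBelow]
    constructor
    · rintro ⟨hp, hd⟩
      rcases hp.dvd_mul.1 hd with h | h
      · have := hp.dvd_factorial.1 h; exact ⟨by omega, hp⟩
      · have := hp.dvd_factorial.1 h; exact ⟨by omega, hp⟩
    · rintro ⟨h, hp⟩
      exact ⟨hp, Dvd.dvd.mul_right (hp.dvd_factorial.2 (by omega)) _⟩
  have hinf : (Set.ofPred Nat.Prime).Infinite := Nat.infinite_setOfPred_prime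
  have hmono := Nat.nth_strictMono hinf
  have hcard : (Nat.primesBelow (α + 1)).card = n ↔
      (Nat.nth Nat.Prime (n - 1) ≤ α ∧ α < Nat.nth Nat.Prime n) := by
    rw [Nat.primesBelow_card_eq_primeCounting', Nat.primeCounting']
    have h1 : Nat.count Nat.Prime (α + 1) ≤ n ↔ α + 1 ≤ Nat.nth Nat.Prime n :=
      Nat.count_le_iff_le_nth hinf
    have h2 : Nat.count Nat.Prime (α + 1) ≤ n - 1 ↔ α + 1 ≤ Nat.nth Nat.Prime (n - 1) :=
      Nat.count_le_iff_le_nth hinf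
    omega
  rw [hset, Set.ncard_coe_finset, hcard, and_assoc]
  refine and_congr_right fun hA => and_congr_right fun hB => ?_
  simp only [Finset.mem_coe, Nat.mem_primesBelow]
  obtain ⟨m, rfl⟩ : ∃ m, n = m + 2 := ⟨n - 2, by omega⟩
  simp only [show m + 2 - 1 = m + 1 by omega, show m + 2 - 2 = m by omega] at *
  have hlt : Nat.nth Nat.Prime m < Nat.nth Nat.Prime (m + 1) := hmono (Nat.lt_succ_self m)
  have hpm := Nat.prime_nth_prime m
  have hpm1 := Nat.prime_nth_prime (m + 1)
  constructor
  · intro h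
    by_contra hcon
    obtain ⟨⟨a, b⟩, hg⟩ := h _ _ ⟨by omega, hpm1⟩ ⟨by omega, hpm⟩ hlt.ne'
    rw [Prod.orderOf_mk] at hg
    have key : ∀ r : ℕ, r.Prime → β < r → r ∣ Nat.nth Nat.Prime (m + 1) * Nat.nth Nat.Prime m →
        r ∣ orderOf a := by
      intro r hr hrb hd
      rw [← hg] at hd
      rcases hr.dvd_mul.1 (hd.trans (Nat.lcm_dvd_mul _ _)) with h | h
      · exact h
      · have := pg_order_le hr b h; omega
    have h1 := pg_perm_order hpm1 hpm hlt.ne' a (key _ hpm1 (by omega) (dvd_mul_right _ _))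
      (key _ hpm (by omega) (dvd_mul_left _ _))
    have h2 := pg_nth_le m
    omega
  · intro h
    have main : ∀ p q : ℕ, p < α + 1 → p.Prime → q.Prime → q < p →
        ∃ g : Equiv.Perm (Fin α) × Equiv.Perm (Fin β), orderOf g = p * q := by
      intro p q hpa hp hq hqp
      have hqb : q ≤ β := by
        refine le_trans ?_ h
        have hp2 : p < Nat.nth Nat.Prime (m + 2) := by omega
        rw [← Nat.nth_count hp] at hqp hp2
        rw [← Nat.nth_count hq] at hqp ⊢
        have i1 := hmono.lt_iff_lt.1 hqp
        have i2 := hmono.lt_iff_lt.1 hp2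
        exact hmono.monotone (by omega)
      obtain ⟨a, ha⟩ := pg_exists_order (k := α) hp (by omega)
      obtain ⟨b, hb⟩ := pg_exists_order (k := β) hq hqb
      refine ⟨(a, b), ?_⟩
      rw [Prod.orderOf_mk, ha, hb]
      exact ((Nat.coprime_primes hp hq).2 hqp.ne').lcm_eq_mul
    rintro p q ⟨hpa, hp⟩ ⟨hqa, hq⟩ hne
    rcases lt_or_gt_of_ne hne with hl | hl
    · rw [mul_comm]
      exact main q p hqa hq hp hl
    · exact main p q hpa hp hq hl
end

section
/- Let Γ be a simple graph on a finite vertex type V. Suppose u, v are adjacent vertices with Equiv.swap u v an automorphism of Γ, and suppose w and x are vertices each structurally equivalent to u (i.e., each of Equiv.swap u w and Equiv.swap u x is an automorphism of Γ, or the vertex equals u). If w ≠ x, then Γ.Adj w x. In other words, if a structural equivalence class contains an edge, then the induced subgraph on that class is complete. -/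
/-- if a structural equivalence class contains an edge, then the induced
subgraph on that class is complete. Concretely: if `u` and `v` are adjacent with
`Equiv.swap u v` an automorphism of `Γ`, and `w`, `x` are each structurally
equivalent to `u` (or equal to `u`), then `w ≠ x` implies `Γ.Adj w x`. -/
theorem class_with_edge_is_complete {V : Type*} [Fintype V] [DecidableEq V]
    (Γ : SimpleGraph V) (u v w x : V) (hadj : Γ.Adj u v)
    (hswap : ∀ a b : V, Γ.Adj (Equiv.swap u v a) (Equiv.swap u v b) ↔ Γ.Adj a b)
    (hw : w = u ∨ ∀ a b : V, Γ.Adj (Equiv.swap u w a) (Equiv.swap u w b) ↔ Γ.Adj a b)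
    (hx : x = u ∨ ∀ a b : V, Γ.Adj (Equiv.swap u x a) (Equiv.swap u x b) ↔ Γ.Adj a b)
    (hwx : w ≠ x) :
    Γ.Adj w x := by
  have key : ∀ y : V, y ≠ u →
      (y = u ∨ ∀ a b : V, Γ.Adj (Equiv.swap u y a) (Equiv.swap u y b) ↔ Γ.Adj a b) →
      Γ.Adj u y := by
    intro y hyu hy
    have hy := hy.resolve_left hyu
    by_cases hyv : y = v
    · rw [hyv]; exact hadj
    · have h1 := (hy u v).2 hadj
      rw [Equiv.swap_apply_left, Equiv.swap_apply_of_ne_of_ne hadj.ne' (Ne.symm hyv)] at h1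
      have h2 := (hswap y v).2 h1
      rw [Equiv.swap_apply_right, Equiv.swap_apply_of_ne_of_ne hyu hyv] at h2
      exact h2.symm
  by_cases hwu : w = u
  · subst hwu
    exact key x hwx.symm hx
  by_cases hxu : x = u
  · subst hxu
    exact (key w hwx hw).symm
  have h := (hw.resolve_left hwu u x).2 (key x hxu hx)
  rwa [Equiv.swap_apply_left, Equiv.swap_apply_of_ne_of_ne hxu hwx.symm] at h
end

section
/- Let Γ be a simple graph on a finite vertex type V with decidable equality, and let s : Setoid V be a setoid satisfying s.r u v ↔ (u = v ∨ (Γ.Adj u v ∧ Equiv.swap u v is an automorphism of Γ)). Then the rank over ℚ of I + A(Γ) is at most the number of classes of s: Matrix.rank ((1 : Matrix V V ℚ) + Γ.adjMatrix ℚ) ≤ Nat.card (Quotient s). (The classes of s are precisely the vertices of the complete skeleton Ω(Γ), so this says rank(I + A(Γ)) ≤ |V(SΩ(Γ))|.) -/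
/-- the rank of `I + A(Γ)` over `ℚ` is at most the number of classes of
the relation `u = v ∨ (Γ.Adj u v ∧ Equiv.swap u v ∈ Aut(Γ))`, i.e. the number of
vertices of the complete skeleton `Ω(Γ)`. -/
theorem rank_one_add_adjMatrix_le {V : Type*} [Fintype V] [DecidableEq V]
    (Γ : SimpleGraph V) [DecidableRel Γ.Adj] (s : Setoid V)
    (hs : ∀ u v : V, s.r u v ↔
      (u = v ∨ (Γ.Adj u v ∧
        ∀ a b : V, Γ.Adj (Equiv.swap u v a) (Equiv.swap u v b) ↔ Γ.Adj a b))) :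
    Matrix.rank ((1 : Matrix V V ℚ) + Γ.adjMatrix ℚ) ≤ Nat.card (Quotient s) := by
  classical
  have key : ∀ u v j : V, s.r u v →
      ((1 : Matrix V V ℚ) + Γ.adjMatrix ℚ) u j = ((1 : Matrix V V ℚ) + Γ.adjMatrix ℚ) v j := by
    intro u v j h
    rcases (hs u v).1 h with rfl | ⟨huv, haut⟩
    · rfl
    · have hne := huv.ne
      by_cases hu : j = u
      · subst hu
        simp [Matrix.one_apply, huv.symm, hne.symm]
      · by_cases hv : j = v
        · subst hv
          simp [Matrix.one_apply, huv, hne]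
        · have h1 := haut u j
          rw [Equiv.swap_apply_left, Equiv.swap_apply_of_ne_of_ne hu hv] at h1
          simp [Matrix.one_apply, Ne.symm hu, Ne.symm hv, h1]
  have : Fintype (Quotient s) := Fintype.ofFinite _
  let N : Matrix (Quotient s) V ℚ := fun q j => ((1 : Matrix V V ℚ) + Γ.adjMatrix ℚ) q.out j
  have hN : (1 : Matrix V V ℚ) + Γ.adjMatrix ℚ = N.submatrix (fun v => Quotient.mk s v) id := by
    ext i j
    exact key _ _ _ (s.symm (Quotient.mk_out i))
  rw [hN, Nat.card_eq_fintype_card]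
  exact (Matrix.rank_submatrix_le N _ _).trans N.rank_le_card_height
end

section
/- Let Γ be a simple graph on a finite vertex type V with decidable equality, and let s : Setoid V be a setoid satisfying s.r u v ↔ (u = v ∨ (Γ.Adj u v ∧ Equiv.swap u v is an automorphism of Γ)). If k is the multiplicity of −1 as an eigenvalue of A(Γ), i.e., k = Module.finrank ℚ of the eigenspace of the linear map Matrix.toLin' (Γ.adjMatrix ℚ) for the eigenvalue −1, then k ≥ Fintype.card V − Nat.card (Quotient s); that is, the multiplicity of the −1 eigenvalue is at least |V(Γ)| − |V(SΩ(Γ))|. -/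
/-- the multiplicity of `-1` as an eigenvalue of `A(Γ)` is at least
`|V(Γ)| - |V(SΩ(Γ))|`, where the vertices of the complete skeleton are the classes of
the relation `u = v ∨ (Γ.Adj u v ∧ Equiv.swap u v ∈ Aut(Γ))`. -/
theorem multiplicity_neg_one_ge {V : Type*} [Fintype V] [DecidableEq V]
    (Γ : SimpleGraph V) [DecidableRel Γ.Adj] (s : Setoid V)
    (hs : ∀ u v : V, s.r u v ↔
      (u = v ∨ (Γ.Adj u v ∧
        ∀ a b : V, Γ.Adj (Equiv.swap u v a) (Equiv.swap u v b) ↔ Γ.Adj a b)))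
    (k : ℕ)
    (hk : k = Module.finrank ℚ
      (Module.End.eigenspace (Matrix.toLin' (Γ.adjMatrix ℚ)) (-1))) :
    Fintype.card V - Nat.card (Quotient s) ≤ k := by
  classical
  subst hk
  let T : (V → ℚ) →ₗ[ℚ] (Quotient s → ℚ) :=
    { toFun := fun f q => ∑ y with (Quotient.mk s y) = q, f y
      map_add' := by
        intro f g
        funext q
        simp [Finset.sum_add_distrib]
      map_smul' := by
        intro c f
        funext q
        simp [Finset.mul_sum] }
  have hle : LinearMap.ker T ≤ Module.End.eigenspace (Matrix.toLin' (Γ.adjMatrix ℚ)) (-1) := by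
    intro f hf
    rw [LinearMap.mem_ker] at hf
    have hf' : ∀ q, ∑ y with (Quotient.mk s y) = q, f y = 0 := fun q => congrFun hf q
    rw [Module.End.mem_eigenspace_iff]
    funext x
    have hc : ∀ u v, s.r u v → ((Γ.Adj x u ∨ x = u) ↔ (Γ.Adj x v ∨ x = v)) := by
      intro u v h
      rcases (hs u v).1 h with rfl | ⟨h1, h2⟩
      · rfl
      · by_cases hu : x = u
        · subst hu
          simp [h1]
        · by_cases hv : x = v
          · subst hv
            simp [h1.symm]
          · have h3 := h2 x u
            rw [Equiv.swap_apply_of_ne_of_ne hu hv, Equiv.swap_apply_left] at h3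
            simp [hu, hv, h3]
    have h0 : ∑ y, (if Γ.Adj x y ∨ x = y then f y else 0) = 0 := by
      rw [← Finset.sum_fiberwise Finset.univ (fun y => Quotient.mk s y)]
      apply Finset.sum_eq_zero
      intro q _
      induction q using Quotient.inductionOn with
      | h z =>
        by_cases hz : Γ.Adj x z ∨ x = z
        · rw [← hf' (Quotient.mk s z)]
          apply Finset.sum_congr rfl
          intro y hy
          have hy' := Quotient.exact (Finset.mem_filter.1 hy).2
          rw [if_pos ((hc y z hy').2 hz)]
        · apply Finset.sum_eq_zero
          intro y hy
          have hy' := Quotient.exact (Finset.mem_filter.1 hy).2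
          rw [if_neg (fun h => hz ((hc y z hy').1 h))]
    have h1 : ∑ y, (if Γ.Adj x y ∨ x = y then f y else 0)
        = ∑ y, (if Γ.Adj x y then f y else 0) + f x := by
      have : f x = ∑ y, (if x = y then f y else 0) := by simp
      rw [this, ← Finset.sum_add_distrib]
      apply Finset.sum_congr rfl
      intro y _
      by_cases hxy : x = y
      · subst hxy
        simp
      · simp [hxy]
    have h2 : (Matrix.toLin' (Γ.adjMatrix ℚ)) f x = ∑ y, (if Γ.Adj x y then f y else 0) := by
      simp [Matrix.toLin'_apply, Matrix.mulVec, dotProduct, SimpleGraph.adjMatrix_apply]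
    rw [h2]
    simp only [Pi.smul_apply, smul_eq_mul]
    linarith
  have e1 := LinearMap.finrank_range_add_finrank_ker T
  have e2 := Submodule.finrank_le (LinearMap.range T)
  have e3 := Submodule.finrank_mono hle
  rw [Module.finrank_fintype_fun_eq_card] at e1 e2
  rw [Nat.card_eq_fintype_card]
  omega
end

section
/- Let Γ be a simple graph on a nonempty finite vertex type V with decidable equality. If Matrix.rank ((1 : Matrix V V ℚ) + Γ.adjMatrix ℚ) = 1, then Γ is complete: for all u v : V with u ≠ v, Γ.Adj u v. -/
/-- if `rank (I + A(Γ)) = 1` then `Γ` is complete. -/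
theorem complete_of_rank_one {V : Type*} [Fintype V] [DecidableEq V] [Nonempty V]
    (Γ : SimpleGraph V) [DecidableRel Γ.Adj]
    (h : Matrix.rank ((1 : Matrix V V ℚ) + Γ.adjMatrix ℚ) = 1) :
    ∀ u v : V, u ≠ v → Γ.Adj u v := by
  intro u v huv
  by_contra hn
  obtain ⟨w, hw⟩ := finrank_le_one_iff.1 (le_of_eq h)
  have key : ∀ j, ∃ c : ℚ, ∀ i, c * w.1 i = ((1 : Matrix V V ℚ) + Γ.adjMatrix ℚ) i j := by
    intro j
    obtain ⟨c, hc⟩ := hw ⟨_, LinearMap.mem_range_self _ (Pi.single j 1)⟩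
    refine ⟨c, fun i => ?_⟩
    have := congrFun (congrArg Subtype.val hc) i
    dsimp only at this
    rw [Matrix.mulVecLin_apply, Matrix.mulVec_single_one] at this
    exact this
  obtain ⟨c, hc⟩ := key u
  obtain ⟨d, hd⟩ := key v
  have h1 := hc u
  have h2 := hc v
  have h3 := hd v
  have hn' : ¬ Γ.Adj v u := fun h => hn h.symm
  simp [Matrix.one_apply, huv.symm, hn'] at h1 h2 h3
  rcases h2 with h2 | h2 <;> simp [h2] at h1 h3
end

section
/- Let Γ be a simple graph on a finite vertex type V with decidable equality. If Matrix.rank ((1 : Matrix V V ℚ) + Γ.adjMatrix ℚ) = 2, then Γ is the disjoint union of two complete graphs: there exists a set A : Set V with A and its complement both nonempty such that for all u v : V, Γ.Adj u v ↔ (u ≠ v ∧ (u ∈ A ↔ v ∈ A)). -/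
/-- if `rank (I + A(Γ)) = 2` then `Γ` is the disjoint union of two
complete graphs. -/
theorem union_two_cliques_of_rank_two {V : Type*} [Fintype V] [DecidableEq V]
    (Γ : SimpleGraph V) [DecidableRel Γ.Adj]
    (h : Matrix.rank ((1 : Matrix V V ℚ) + Γ.adjMatrix ℚ) = 2) :
    ∃ A : Set V, A.Nonempty ∧ Aᶜ.Nonempty ∧
      ∀ u v : V, Γ.Adj u v ↔ (u ≠ v ∧ (u ∈ A ↔ v ∈ A)) := by
  have key : ∀ f : Fin 3 → V,
      (((1 : Matrix V V ℚ) + Γ.adjMatrix ℚ).submatrix f f).det = 0 := by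
    intro f
    by_contra hd
    have h1 := Matrix.rank_of_det_ne_zero hd
    have h2 := Matrix.rank_submatrix_le ((1 : Matrix V V ℚ) + Γ.adjMatrix ℚ) f f
    rw [h1, h] at h2
    simp at h2
  have trans : ∀ u v w : V, Γ.Adj u v → Γ.Adj v w → u ≠ w → Γ.Adj u w := by
    intro u v w huv hvw huw
    by_contra hn
    have hk := key ![u, v, w]
    have hn' : ¬ Γ.Adj w u := fun x => hn x.symm
    rw [Matrix.det_fin_three] at hk
    simp [Matrix.one_apply, huv, huv.symm, hvw, hvw.symm, hn, hn', huw,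
      huw.symm, huv.ne, huv.ne', hvw.ne, hvw.ne'] at hk
  have three : ∀ u v w : V, u ≠ v → v ≠ w → u ≠ w → ¬ Γ.Adj u v → ¬ Γ.Adj v w →
      Γ.Adj u w := by
    intro u v w huv hvw huw a b
    by_contra hn
    have hk := key ![u, v, w]
    have hn' : ¬ Γ.Adj w u := fun x => hn x.symm
    have a' : ¬ Γ.Adj v u := fun x => a x.symm
    have b' : ¬ Γ.Adj w v := fun x => b x.symm
    rw [Matrix.det_fin_three] at hk
    simp [Matrix.one_apply, huv, huv.symm, hvw, hvw.symm, hn, hn', huw,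
      huw.symm, a, a', b, b'] at hk
  have two : ∃ a b : V, a ≠ b ∧ ¬ Γ.Adj a b := by
    by_contra! hc
    have e : (1 : Matrix V V ℚ) + Γ.adjMatrix ℚ = Matrix.vecMulVec (fun _ => 1) (fun _ => 1) := by
      ext i j
      by_cases hij : i = j
      · subst hij; simp [Matrix.vecMulVec_apply]
      · simp [Matrix.vecMulVec_apply, hij, hc i j hij]
    have := Matrix.rank_vecMulVec_le (fun _ : V => (1 : ℚ)) (fun _ : V => (1 : ℚ))
    rw [← e, h] at this
    omega
  obtain ⟨a, b, hab, hnab⟩ := two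
  have symm : ∀ u v, Γ.Adj u v → Γ.Adj v u := fun u v x => x.symm
  have irr : ∀ u, ¬ Γ.Adj u u := fun u => Γ.irrefl
  refine ⟨{v | v = a ∨ Γ.Adj a v}, ⟨a, Or.inl rfl⟩, ⟨b, ?_⟩, ?_⟩
  · rintro (rfl | hb)
    · exact hab rfl
    · exact hnab hb
  · intro u v
    simp only [Set.mem_ofPred_eq]
    grind
end

section
/- Let Γ be a simple graph on a finite vertex type V with decidable equality. If Matrix.rank ((1 : Matrix V V ℚ) + Γ.adjMatrix ℚ) = 3, then either (i) Γ is the disjoint union of three complete graphs: there exists a surjection f : V → Fin 3 with Γ.Adj u v ↔ (u ≠ v ∧ f u = f v) for all u v; or (ii) Γ is a complete graph minus a complete bipartite graph K_{l,m} with l, m ≥ 1 and l + m ≤ |V| − 1: there exist disjoint nonempty sets L M : Set V with L ∪ M ≠ Set.univ such that for all u v, Γ.Adj u v ↔ (u ≠ v ∧ ¬((u ∈ L ∧ v ∈ M) ∨ (u ∈ M ∧ v ∈ L))). -/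
theorem rts_alg (a b d x y z p q r : ℚ) (ha : a = 0 ∨ a = 1) (hb : b = 0 ∨ b = 1)
    (hd : d = 0 ∨ d = 1) (hx : x = 0 ∨ x = 1) (hy : y = 0 ∨ y = 1) (hz : z = 0 ∨ z = 1)
    (hdet : 1 + 2 * a * b * d - a ^ 2 - b ^ 2 - d ^ 2 ≠ 0)
    (h1 : x = p + q * a + r * b) (h2 : y = p * a + q + r * d) (h3 : z = p * b + q * d + r)
    (h4 : 1 = p * x + q * y + r * z) :
    (p = 1 ∧ q = 0 ∧ r = 0) ∨ (p = 0 ∧ q = 1 ∧ r = 0) ∨ (p = 0 ∧ q = 0 ∧ r = 1) := by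
  rcases ha with rfl | rfl <;> rcases hb with rfl | rfl <;> rcases hd with rfl | rfl <;>
  norm_num at hdet <;>
  rcases hx with rfl | rfl <;> rcases hy with rfl | rfl <;> rcases hz with rfl | rfl <;>
  first
  | (exfalso; linarith)
  | (refine Or.inl ⟨?_, ?_, ?_⟩ <;> linarith)
  | (refine Or.inr (Or.inl ⟨?_, ?_, ?_⟩) <;> linarith)
  | (refine Or.inr (Or.inr ⟨?_, ?_, ?_⟩) <;> linarith)

theorem rts_path {V : Type*} (Γ : SimpleGraph V) (f : V → Fin 3)
    (hf : Function.Surjective f) (i j k : Fin 3) (hij : i ≠ j) (hik : i ≠ k) (hjk : j ≠ k)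
    (hadj : ∀ u v : V, Γ.Adj u v ↔
      (u ≠ v ∧ ¬((f u = i ∧ f v = j) ∨ (f u = j ∧ f v = i)))) :
    (∃ L M : Set V, Disjoint L M ∧ L.Nonempty ∧ M.Nonempty ∧ L ∪ M ≠ Set.univ ∧
      ∀ u v : V, Γ.Adj u v ↔ (u ≠ v ∧ ¬((u ∈ L ∧ v ∈ M) ∨ (u ∈ M ∧ v ∈ L)))) := by
  obtain ⟨a, ha⟩ := hf i
  obtain ⟨b, hb⟩ := hf j
  obtain ⟨c, hc⟩ := hf k
  refine ⟨{u | f u = i}, {u | f u = j}, ?_, ⟨a, ha⟩, ⟨b, hb⟩, ?_, ?_⟩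
  · rw [Set.disjoint_left]
    intro u hu hv
    exact hij (hu.symm.trans hv)
  · intro h
    have : c ∈ ({u | f u = i} ∪ {u | f u = j} : Set V) := by rw [h]; trivial
    rcases this with h | h
    · exact hik (h.symm.trans hc)
    · exact hjk (h.symm.trans hc)
  · exact hadj

theorem rts_fin {V : Type*} (Γ : SimpleGraph V) (f : V → Fin 3)
    (hf : Function.Surjective f) (B : Fin 3 → Fin 3 → ℚ)
    (h01 : ∀ i j, B i j = 0 ∨ B i j = 1) (hdiag : ∀ i, B i i = 1) (hsymm : ∀ i j, B i j = B j i)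
    (hdet : 1 + 2 * B 0 1 * B 0 2 * B 1 2 - B 0 1 ^ 2 - B 0 2 ^ 2 - B 1 2 ^ 2 ≠ 0)
    (hadj : ∀ u v : V, Γ.Adj u v ↔ (u ≠ v ∧ B (f u) (f v) = 1)) :
    (∃ f : V → Fin 3, Function.Surjective f ∧
      ∀ u v : V, Γ.Adj u v ↔ (u ≠ v ∧ f u = f v)) ∨
    (∃ L M : Set V, Disjoint L M ∧ L.Nonempty ∧ M.Nonempty ∧ L ∪ M ≠ Set.univ ∧
      ∀ u v : V, Γ.Adj u v ↔ (u ≠ v ∧ ¬((u ∈ L ∧ v ∈ M) ∨ (u ∈ M ∧ v ∈ L)))) := by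
  have s1 := hsymm 1 0
  have s2 := hsymm 2 0
  have s3 := hsymm 2 1
  have d0 := hdiag 0
  have d1 := hdiag 1
  have d2 := hdiag 2
  rcases h01 0 1 with a | a <;> rcases h01 0 2 with b | b <;> rcases h01 1 2 with c | c <;>
    rw [a, b, c] at hdet <;> norm_num at hdet <;> rw [a] at s1 <;> rw [b] at s2 <;> rw [c] at s3
  · left
    refine ⟨f, hf, fun u v => ?_⟩
    rw [hadj]
    refine and_congr_right fun _ => ?_
    generalize f u = x
    generalize f v = y
    fin_cases x <;> fin_cases y <;> simp [*]
  · right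
    refine rts_path Γ f hf 0 1 2 (by decide) (by decide) (by decide) fun u v => ?_
    rw [hadj]
    refine and_congr_right fun _ => ?_
    generalize f u = x
    generalize f v = y
    fin_cases x <;> fin_cases y <;> simp [*]
  · right
    refine rts_path Γ f hf 0 2 1 (by decide) (by decide) (by decide) fun u v => ?_
    rw [hadj]
    refine and_congr_right fun _ => ?_
    generalize f u = x
    generalize f v = y
    fin_cases x <;> fin_cases y <;> simp [*]
  · right
    refine rts_path Γ f hf 1 2 0 (by decide) (by decide) (by decide) fun u v => ?_
    rw [hadj]
    refine and_congr_right fun _ => ?_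
    generalize f u = x
    generalize f v = y
    fin_cases x <;> fin_cases y <;> simp [*]

theorem rank_three_structure {V : Type*} [Fintype V] [DecidableEq V]
    (Γ : SimpleGraph V) [DecidableRel Γ.Adj]
    (h : Matrix.rank ((1 : Matrix V V ℚ) + Γ.adjMatrix ℚ) = 3) :
    (∃ f : V → Fin 3, Function.Surjective f ∧
      ∀ u v : V, Γ.Adj u v ↔ (u ≠ v ∧ f u = f v)) ∨
    (∃ L M : Set V, Disjoint L M ∧ L.Nonempty ∧ M.Nonempty ∧ L ∪ M ≠ Set.univ ∧
      ∀ u v : V, Γ.Adj u v ↔ (u ≠ v ∧ ¬((u ∈ L ∧ v ∈ M) ∨ (u ∈ M ∧ v ∈ L)))) := by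
  set A : Matrix V V ℚ := (1 : Matrix V V ℚ) + Γ.adjMatrix ℚ with hA
  have h1 : ∀ u, A u u = 1 := fun u => by simp [hA]
  have hs : ∀ u v, A u v = A v u := fun u v => by
    simp [hA, Matrix.one_apply, Γ.adj_comm u v, eq_comm]
  have h01 : ∀ u v, A u v = 0 ∨ A u v = 1 := fun u v => by
    by_cases e : u = v
    · subst e; exact Or.inr (h1 u)
    · by_cases g : Γ.Adj u v <;> simp [hA, Matrix.one_apply, e, g]
  have hadj : ∀ u v, Γ.Adj u v ↔ (u ≠ v ∧ A u v = 1) := fun u v => by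
    by_cases e : u = v
    · subst e; simp
    · by_cases g : Γ.Adj u v <;> simp [hA, Matrix.one_apply, e, g]
  clear_value A
  rw [Matrix.rank_eq_finrank_span_row] at h
  obtain ⟨g, hg1, hg2, hg3⟩ : ∃ g : Fin 3 → V → ℚ, (∀ i, g i ∈ Set.range A.row) ∧
      Submodule.span ℚ (Set.range g) = Submodule.span ℚ (Set.range A.row) ∧
      LinearIndependent ℚ g := by
    have := Submodule.exists_fun_fin_finrank_span_eq ℚ (Set.range A.row)
    rw [h] at this
    exact this
  choose s hgs using hg1
  have hgs' : ∀ i v, g i v = A (s i) v := fun i v => by rw [← hgs i]; rfl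
  have hc : ∀ u, ∃ c : Fin 3 → ℚ, ∀ v, A u v = ∑ i, c i * A (s i) v := by
    intro u
    have : A.row u ∈ Submodule.span ℚ (Set.range g) := by
      rw [hg2]; exact Submodule.subset_span ⟨u, rfl⟩
    obtain ⟨c, hc⟩ := (Submodule.mem_span_range_iff_exists_fun ℚ).1 this
    refine ⟨c, fun v => ?_⟩
    have := congrFun hc v
    simp only [Finset.sum_apply, Pi.smul_apply, smul_eq_mul, hgs'] at this
    exact this.symm
  choose c hc using hc
  have hdet0 : (A.submatrix s s).det ≠ 0 := by
    intro h0
    obtain ⟨w, hw, hw0⟩ := Matrix.exists_mulVec_eq_zero_iff.2 h0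
    apply hw
    have : ∀ i, ∑ j, A (s i) (s j) * w j = 0 := fun i => congrFun hw0 i
    funext j
    refine Fintype.linearIndependent_iff.1 hg3 w ?_ j
    funext u
    simp only [Finset.sum_apply, Pi.smul_apply, smul_eq_mul, hgs', Pi.zero_apply]
    calc ∑ j, w j * A (s j) u = ∑ j, ∑ i, c u i * (A (s i) (s j) * w j) := by
          refine Finset.sum_congr rfl fun j _ => ?_
          rw [hs (s j) u, hc u (s j), Finset.mul_sum]
          exact Finset.sum_congr rfl fun i _ => by ring
      _ = 0 := by
          rw [Finset.sum_comm]
          simp [← Finset.mul_sum, this]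
  have hdet : 1 + 2 * A (s 0) (s 1) * A (s 0) (s 2) * A (s 1) (s 2) - A (s 0) (s 1) ^ 2
      - A (s 0) (s 2) ^ 2 - A (s 1) (s 2) ^ 2 ≠ 0 := by
    convert hdet0 using 1
    rw [Matrix.det_fin_three]
    simp only [Matrix.submatrix_apply, h1, hs (s 1) (s 0), hs (s 2) (s 0), hs (s 2) (s 1)]
    ring
  have hf : ∀ u, ∃ i, ∀ v, A u v = A (s i) v := by
    intro u
    have e0 := hc u (s 0)
    have e1 := hc u (s 1)
    have e2 := hc u (s 2)
    have e3 := hc u u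
    simp only [Fin.sum_univ_three, h1, hs (s 1) (s 0), hs (s 2) (s 0), hs (s 2) (s 1), mul_one,
      hs (s _) u] at e0 e1 e2 e3
    rcases rts_alg _ _ _ _ _ _ _ _ _ (h01 _ _) (h01 _ _) (h01 _ _) (h01 _ _) (h01 _ _)
      (h01 _ _) hdet e0 e1 e2 e3 with ⟨p, q, r⟩ | ⟨p, q, r⟩ | ⟨p, q, r⟩
    · exact ⟨0, fun v => by rw [hc u v]; simp [Fin.sum_univ_three, p, q, r]⟩
    · exact ⟨1, fun v => by rw [hc u v]; simp [Fin.sum_univ_three, p, q, r]⟩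
    · exact ⟨2, fun v => by rw [hc u v]; simp [Fin.sum_univ_three, p, q, r]⟩
  choose f hf using hf
  refine rts_fin Γ f (fun i => ⟨s i, ?_⟩) (fun i j => A (s i) (s j)) (fun _ _ => h01 _ _)
    (fun _ => h1 _) (fun _ _ => hs _ _) hdet fun u v => ?_
  · apply hg3.injective
    funext v
    rw [hgs', hgs', ← hf]
  · rw [hadj, hf u v, hs, hf v, hs]
end
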